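/- arXiv:2503.17101 — 2 statements merged into one kernel-verified Lean document; each statement's English description precedes it below -/
import Mathlib

section
/- Let A ∈ ℝ^{m×n} and let X ∈ ℝ^{n×p} have full row rank n. Let S ∈ ℝ^{n×n} be the Cholesky factor of X Xᵀ, i.e., a lower triangular matrix with positive diagonal entries satisfying S Sᵀ = X Xᵀ. Let A S = Σ_{i=1}^r σ_i u_i v_iᵀ be an SVD of A S, where r = rank(A S), σ_1 ≥ … ≥ σ_r > 0, and (u_i), (v_i) are orthonormal families. For 1 ≤ k ≤ r define the truncation Ã_k = (Σ_{i=1}^k σ_i u_i v_iᵀ) S^{-1}. Then the squared compression loss equals the sum of the squares of the truncated singular values: ‖(A − Ã_k) X‖_F² = Σ_{i=k+1}^r σ_i². -/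
open Matrix Finset

/-- Frobenius norm of a real matrix. -/
noncomputable def frob {m n : ℕ} (M : Matrix (Fin m) (Fin n) ℝ) : ℝ :=
  Real.sqrt (∑ i, ∑ j, (M i j) ^ 2)

theorem frob_sq {m n : ℕ} (M : Matrix (Fin m) (Fin n) ℝ) : frob M ^ 2 = (M * Mᵀ).trace := by
  rw [frob, Real.sq_sqrt (by positivity)]
  simp [Matrix.trace, Matrix.mul_apply, sq]

theorem frob_mul_sq_congr {l m n p : ℕ} (M : Matrix (Fin l) (Fin m) ℝ)
    (Y : Matrix (Fin m) (Fin n) ℝ) (Z : Matrix (Fin m) (Fin p) ℝ) (h : Y * Yᵀ = Z * Zᵀ) :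
    frob (M * Y) ^ 2 = frob (M * Z) ^ 2 := by
  have key : (M * Y) * (M * Y)ᵀ = (M * Z) * (M * Z)ᵀ := by
    rw [transpose_mul, transpose_mul, Matrix.mul_assoc, ← Matrix.mul_assoc Y, h,
      Matrix.mul_assoc M, ← Matrix.mul_assoc Z]
  rw [frob_sq, frob_sq, key]

theorem frob_sq_sum_smul_vecMulVec {m n : ℕ} {ι : Type*} [DecidableEq ι] (s : Finset ι)
    (σ : ι → ℝ) (u : ι → Fin m → ℝ) (v : ι → Fin n → ℝ)
    (hu : ∀ i j, u i ⬝ᵥ u j = if i = j then (1 : ℝ) else 0)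
    (hv : ∀ i j, v i ⬝ᵥ v j = if i = j then (1 : ℝ) else 0) :
    frob (∑ i ∈ s, σ i • vecMulVec (u i) (v i)) ^ 2 = ∑ i ∈ s, σ i ^ 2 := by
  rw [frob_sq, transpose_sum, Matrix.sum_mul, trace_sum]
  refine Finset.sum_congr rfl fun i hi => ?_
  rw [Matrix.mul_sum, trace_sum, Finset.sum_eq_single_of_mem i hi]
  · simp [transpose_vecMulVec, vecMulVec_mul_vecMulVec, trace_vecMulVec, hu, hv, sq]
  · intro j _ hji
    simp [transpose_vecMulVec, vecMulVec_mul_vecMulVec, hv, hji.symm]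

theorem isUnit_det_of_lower_of_diag_pos {n : ℕ} (S : Matrix (Fin n) (Fin n) ℝ)
    (hlow : ∀ i j : Fin n, i < j → S i j = 0) (hdiag : ∀ i, 0 < S i i) : IsUnit S.det := by
  rw [det_of_isLowerTriangular S fun i j hij => hlow i j hij]
  exact (Finset.prod_pos fun i _ => hdiag i).ne'.isUnit

/-- ASVD-I, rank-`k` truncation: with `S` the Cholesky factor of `X Xᵀ` and an SVD of `A S`,
truncating the trailing singular values gives squared loss `Σ_{i>k} σ_i²`. -/
theorem asvd_cholesky_truncation_sq_loss
    (m n p r k : ℕ) (A : Matrix (Fin m) (Fin n) ℝ)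
    (X : Matrix (Fin n) (Fin p) ℝ) (hX : X.rank = n)
    (S : Matrix (Fin n) (Fin n) ℝ)
    (hSlow : ∀ i j : Fin n, i < j → S i j = 0)
    (hSdiag : ∀ i, 0 < S i i)
    (hSS : S * Sᵀ = X * Xᵀ)
    (σ : Fin r → ℝ) (u : Fin r → Fin m → ℝ) (v : Fin r → Fin n → ℝ)
    (hr : (A * S).rank = r)
    (hσpos : ∀ i, 0 < σ i)
    (hσanti : ∀ i j : Fin r, i ≤ j → σ j ≤ σ i)
    (hu : ∀ i j : Fin r, (∑ x, u i x * u j x) = if i = j then (1 : ℝ) else 0)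
    (hv : ∀ i j : Fin r, (∑ x, v i x * v j x) = if i = j then (1 : ℝ) else 0)
    (hAS : A * S = ∑ i : Fin r, σ i • vecMulVec (u i) (v i))
    (hk1 : 1 ≤ k) (hkr : k ≤ r)
    (Ak : Matrix (Fin m) (Fin n) ℝ)
    (hAk : Ak = (∑ i ∈ Finset.univ.filter (fun i : Fin r => (i : ℕ) < k),
        σ i • vecMulVec (u i) (v i)) * S⁻¹) :
    frob ((A - Ak) * X) ^ 2 =
      ∑ i ∈ Finset.univ.filter (fun i : Fin r => k ≤ (i : ℕ)), σ i ^ 2 := by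
  have hB : (A - Ak) * S = ∑ i ∈ Finset.univ.filter (fun i : Fin r => k ≤ (i : ℕ)),
      σ i • vecMulVec (u i) (v i) := by
    rw [Matrix.sub_mul, hAk,
      nonsing_inv_mul_cancel_right _ _ (isUnit_det_of_lower_of_diag_pos S hSlow hSdiag), hAS,
      ← Finset.sum_filter_add_sum_filter_not Finset.univ (fun i : Fin r => (i : ℕ) < k),
      add_sub_cancel_left]
    simp only [not_lt]
  rw [frob_mul_sq_congr _ X S hSS.symm, hB]
  exact frob_sq_sum_smul_vecMulVec _ σ u v hu hv
end

section
/- Let A ∈ ℝ^{m×n} and let X ∈ ℝ^{n×p} have full row rank n. Let X Xᵀ = P Λ Pᵀ be a spectral decomposition with P ∈ ℝ^{n×n} orthogonal and Λ diagonal with positive diagonal entries, and set S = P Λ^{1/2}, where Λ^{1/2} is the diagonal matrix of positive square roots of the diagonal of Λ (so S Sᵀ = X Xᵀ and S is invertible). Let A S = Σ_{i=1}^r σ_i u_i v_iᵀ be an SVD of A S with r = rank(A S). Fix an index j with 1 ≤ j ≤ r and define Ã = (Σ_{i≠j, 1≤i≤r} σ_i u_i v_iᵀ) S^{-1}. Then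 ‖(A − Ã) X‖_F = σ_j. -/
open Matrix Finset

theorem frob_eq_sqrt_trace {m n : ℕ} (M : Matrix (Fin m) (Fin n) ℝ) :
    frob M = Real.sqrt (M * Mᵀ).trace := by
  simp [frob, Matrix.trace, Matrix.mul_apply, sq]

theorem frob_mul_eq_of_gram_eq {m n p q : ℕ} (N : Matrix (Fin m) (Fin n) ℝ)
    {X : Matrix (Fin n) (Fin p) ℝ} {S : Matrix (Fin n) (Fin q) ℝ} (h : X * Xᵀ = S * Sᵀ) :
    frob (N * X) = frob (N * S) := by
  have gram : (N * X) * (N * X)ᵀ = (N * S) * (N * S)ᵀ := by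
    rw [transpose_mul, transpose_mul, Matrix.mul_assoc, ← Matrix.mul_assoc X, h,
      Matrix.mul_assoc S, ← Matrix.mul_assoc N]
  rw [frob_eq_sqrt_trace, frob_eq_sqrt_trace, gram]

theorem frob_smul_vecMulVec {m n : ℕ} {c : ℝ} (hc : 0 ≤ c) {a : Fin m → ℝ} {b : Fin n → ℝ}
    (ha : ∑ x, a x * a x = 1) (hb : ∑ x, b x * b x = 1) :
    frob (c • vecMulVec a b) = c := by
  have key : ∑ i, ∑ k, ((c • vecMulVec a b) i k) ^ 2 = c ^ 2 := by
    calc ∑ i, ∑ k, ((c • vecMulVec a b) i k) ^ 2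
        = c ^ 2 * ((∑ i, a i * a i) * ∑ k, b k * b k) := by
          rw [Finset.sum_mul_sum, Finset.mul_sum]
          refine Finset.sum_congr rfl fun i _ => ?_
          rw [Finset.mul_sum]
          refine Finset.sum_congr rfl fun k _ => ?_
          simp only [Matrix.smul_apply, vecMulVec_apply, smul_eq_mul]
          ring
      _ = c ^ 2 := by rw [ha, hb, mul_one, mul_one]
  rw [frob, key, Real.sqrt_sq hc]

/-- ASVD-II, single truncation: with `S = P Λ^{1/2}` from a spectral decomposition
`X Xᵀ = P Λ Pᵀ` and an SVD of `A S`, truncating the `j`-th singular term yields compression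
loss exactly `σ_j`. -/
theorem asvd_spectral_single_truncation_loss
    (m n p r : ℕ) (A : Matrix (Fin m) (Fin n) ℝ)
    (X : Matrix (Fin n) (Fin p) ℝ) (hX : X.rank = n)
    (P : Matrix (Fin n) (Fin n) ℝ) (d : Fin n → ℝ)
    (hP : Pᵀ * P = 1) (hd : ∀ i, 0 < d i)
    (hspec : X * Xᵀ = P * Matrix.diagonal d * Pᵀ)
    (S : Matrix (Fin n) (Fin n) ℝ)
    (hSdef : S = P * Matrix.diagonal (fun i => Real.sqrt (d i)))
    (σ : Fin r → ℝ) (u : Fin r → Fin m → ℝ) (v : Fin r → Fin n → ℝ)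
    (hr : (A * S).rank = r)
    (hσpos : ∀ i, 0 < σ i)
    (hσanti : ∀ i j : Fin r, i ≤ j → σ j ≤ σ i)
    (hu : ∀ i j : Fin r, (∑ x, u i x * u j x) = if i = j then (1 : ℝ) else 0)
    (hv : ∀ i j : Fin r, (∑ x, v i x * v j x) = if i = j then (1 : ℝ) else 0)
    (hAS : A * S = ∑ i : Fin r, σ i • vecMulVec (u i) (v i))
    (j : Fin r)
    (Atil : Matrix (Fin m) (Fin n) ℝ)
    (hAtil : Atil = (∑ i ∈ Finset.univ.filter (fun i : Fin r => i ≠ j),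
        σ i • vecMulVec (u i) (v i)) * S⁻¹) :
    frob ((A - Atil) * X) = σ j := by
  have hgram : X * Xᵀ = S * Sᵀ := by
    have hsq : Matrix.diagonal (fun i => Real.sqrt (d i)) *
        Matrix.diagonal (fun i => Real.sqrt (d i)) = Matrix.diagonal d := by
      rw [diagonal_mul_diagonal]
      congr 1
      funext i
      exact Real.mul_self_sqrt (hd i).le
    rw [hspec, hSdef, transpose_mul, diagonal_transpose, ← hsq]
    simp only [Matrix.mul_assoc]
  have hSdet : IsUnit S.det := by
    rw [hSdef, det_mul, det_diagonal]
    refine (isUnit_det_of_left_inverse hP).mul (IsUnit.mk0 _ ?_)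
    exact Finset.prod_ne_zero_iff.mpr fun i _ => (Real.sqrt_pos.mpr (hd i)).ne'
  have hdiff : (A - Atil) * S = σ j • vecMulVec (u j) (v j) := by
    rw [Matrix.sub_mul, hAtil, nonsing_inv_mul_cancel_right _ _ hSdet, hAS, sub_eq_iff_eq_add,
      Finset.filter_ne']
    exact (Finset.add_sum_erase _ _ (Finset.mem_univ j)).symm
  rw [frob_mul_eq_of_gram_eq _ hgram, hdiff]
  exact frob_smul_vecMulVec (hσpos j).le (by simpa using hu j j) (by simpa using hv j j)
end
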